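/- N_=(4) = 8: every graph on 8 vertices contains a regular induced subgraph of order exactly 4, and there exists a graph on 7 vertices containing no regular induced subgraph of order exactly 4. -/

import Mathlib

/-- The induced subgraph of `G` on `s` is regular: all vertices of `s` have the same
number of neighbours within `s`. -/
def RegOn {V : Type*} (G : SimpleGraph V) (s : Set V) : Prop :=
  ∃ d : ℕ, ∀ v ∈ s, (s ∩ {w | G.Adj v w}).ncard = d

/-- `G` has a regular induced subgraph of order exactly `k`. -/
def HasRegEq {V : Type*} (G : SimpleGraph V) (k : ℕ) : Prop :=
  ∃ s : Set V, s.ncard = k ∧ RegOn G s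

/-- `G` has a regular induced subgraph of order at least `k`. -/
def HasRegGe {V : Type*} (G : SimpleGraph V) (k : ℕ) : Prop :=
  ∃ s : Set V, k ≤ s.ncard ∧ RegOn G s

/-- The least `n` such that every graph on `n` vertices has a regular induced subgraph
of order exactly `k`. -/
noncomputable def Neq (k : ℕ) : ℕ :=
  sInf {n | ∀ G : SimpleGraph (Fin n), HasRegEq G k}

/-- The least `n` such that every graph on `n` vertices has a regular induced subgraph
of order at least `k`. -/
noncomputable def Nge (k : ℕ) : ℕ :=
  sInf {n | ∀ G : SimpleGraph (Fin n), HasRegGe G k}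

open Finset in
/-- The number of neighbours of `v` among `v` and three distinct vertices. -/
theorem ncard_inter_adj {V : Type*} (G : SimpleGraph V) [DecidableRel G.Adj] {v a b c : V}
    (hab : a ≠ b) (hac : a ≠ c) (hbc : b ≠ c) :
    (({v, a, b, c} : Set V) ∩ {w | G.Adj v w}).ncard =
      (if G.Adj v a then 1 else 0) + (if G.Adj v b then 1 else 0) +
        (if G.Adj v c then 1 else 0) := by
  classical
  have h : (({v, a, b, c} : Set V) ∩ {w | G.Adj v w}) =
      ↑(({a, b, c} : Finset V).filter (G.Adj v)) := by
    ext w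
    simp only [Set.mem_inter_iff, Set.mem_insert_iff, Set.mem_singleton_iff, Set.mem_ofPred_eq,
      coe_filter, Finset.mem_insert, Finset.mem_singleton]
    constructor
    · rintro ⟨rfl | h, hw⟩
      · exact absurd hw (G.loopless.irrefl _)
      · exact ⟨h, hw⟩
    · rintro ⟨h, hw⟩
      exact ⟨Or.inr h, hw⟩
  rw [h, Set.ncard_coe_finset, Finset.card_filter, Finset.sum_insert (by simp [hab, hac]),
    Finset.sum_insert (by simp [hbc]), Finset.sum_singleton, add_assoc]

/-- A graph on four vertices is regular if and only if it is a union of perfect matchings of `K₄`. -/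
theorem regOn_four_iff {V : Type*} (G : SimpleGraph V) {a b c d : V}
    (hab : a ≠ b) (hac : a ≠ c) (had : a ≠ d) (hbc : b ≠ c) (hbd : b ≠ d) (hcd : c ≠ d) :
    RegOn G {a, b, c, d} ↔
      (G.Adj a b ↔ G.Adj c d) ∧ (G.Adj a c ↔ G.Adj b d) ∧ (G.Adj a d ↔ G.Adj b c) := by
  classical
  have ha := ncard_inter_adj G (v := a) hbc hbd hcd
  have hb := ncard_inter_adj G (v := b) hac had hcd
  have hc := ncard_inter_adj G (v := c) hab had hbd
  have hd := ncard_inter_adj G (v := d) hab hac hbc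
  rw [Set.insert_comm b a] at hb
  rw [Set.insert_comm c a, Set.insert_comm c b] at hc
  rw [Set.insert_comm d a, Set.insert_comm d b, Set.pair_comm d c] at hd
  simp only [G.adj_comm b a, G.adj_comm c a, G.adj_comm c b, G.adj_comm d a, G.adj_comm d b,
    G.adj_comm d c] at hb hc hd
  unfold RegOn
  simp only [Set.mem_insert_iff, Set.mem_singleton_iff, forall_eq_or_imp, forall_eq,
    ha, hb, hc, hd]
  by_cases G.Adj a b <;> by_cases G.Adj a c <;> by_cases G.Adj a d <;>
    by_cases G.Adj b c <;> by_cases G.Adj b d <;> by_cases G.Adj c d <;> simp [*]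

theorem hasRegEq_four_iff {V : Type*} (G : SimpleGraph V) :
    HasRegEq G 4 ↔ ∃ a b c d : V, (a ≠ b ∧ a ≠ c ∧ a ≠ d ∧ b ≠ c ∧ b ≠ d ∧ c ≠ d) ∧
      (G.Adj a b ↔ G.Adj c d) ∧ (G.Adj a c ↔ G.Adj b d) ∧ (G.Adj a d ↔ G.Adj b c) := by
  classical
  constructor
  · rintro ⟨s, hs, hr⟩
    obtain ⟨a, t, hat, rfl, ht⟩ := (Set.ncard_eq_succ (Set.finite_of_ncard_ne_zero (by omega))).1 hs
    obtain ⟨b, c, d, hbc, hbd, hcd, rfl⟩ := Set.ncard_eq_three.1 ht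
    simp only [Set.mem_insert_iff, Set.mem_singleton_iff, not_or] at hat
    obtain ⟨hab, hac, had⟩ := hat
    exact ⟨a, b, c, d, ⟨hab, hac, had, hbc, hbd, hcd⟩,
      (regOn_four_iff G hab hac had hbc hbd hcd).1 hr⟩
  · rintro ⟨a, b, c, d, ⟨hab, hac, had, hbc, hbd, hcd⟩, h⟩
    refine ⟨{a, b, c, d}, ?_, (regOn_four_iff G hab hac had hbc hbd hcd).2 h⟩
    rw [Set.ncard_insert_of_notMem (by simp [hab, hac, had]),
      Set.ncard_eq_three.2 ⟨b, c, d, hbc, hbd, hcd, rfl⟩]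

theorem HasRegEq.of_comap {V W : Type*} {G : SimpleGraph W} (e : V ↪ W)
    (h : HasRegEq (G.comap e) 4) : HasRegEq G 4 := by
  rw [hasRegEq_four_iff] at h ⊢
  obtain ⟨a, b, c, d, hne, h⟩ := h
  exact ⟨e a, e b, e c, e d, by simpa using hne, h⟩

/-- The list `[f (n - 1), …, f 0]`. -/
def descList {α : Type*} (f : ℕ → α) : ℕ → List α
  | 0 => []
  | n + 1 => f n :: descList f n

/-- Whether some position `i` satisfies `us[i] = y`, `vs[i] = x` and `ws[i] = b`. -/
def anyMatch (b x y : Bool) : List Bool → List Bool → List Bool → Bool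
  | u :: us, v :: vs, w :: ws => (u == y && (v == x && w == b)) || anyMatch b x y us vs ws
  | _, _, _ => false

/-- If `xs` and `ys` list the adjacencies of two vertices `k` and `l` to the vertices before `k`, in
descending order, `rows` lists the adjacencies of each of these vertices to those before it, and `b`
is the adjacency of `k` and `l`, this tests whether some `i < j < k` form a regular quadruple
with `k` and `l`. -/
def anyQuad (b : Bool) : List Bool → List Bool → List (List Bool) → Bool
  | x :: xs, y :: ys, r :: rows => anyMatch b x y xs ys r || anyQuad b xs ys rows
  | _, _, _ => false

/-- Whether each list of adjacencies of a new vertex to the previous ones creates a regular quadruple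
or satisfies `next`. The rows of the vertices whose adjacency is still to be chosen are in `rest`,
the other rows in `pre`, and the adjacencies already chosen in `c`. -/
def addVertex (next : List Bool → Bool) : List (List Bool) → List (List Bool) → List Bool → Bool
  | [], _, c => next c
  | r :: rest, pre, c =>
    (anyQuad true r c pre || addVertex next rest (r :: pre) (true :: c)) &&
    (anyQuad false r c pre || addVertex next rest (r :: pre) (false :: c))

/-- Whether each extension by `n` vertices of the graph given by `rows` creates a regular
quadruple. -/
def forcesQuad : ℕ → List (List Bool) → Bool
  | 0, _ => false
  | n + 1, rows => addVertex (fun c ↦ forcesQuad n (rows ++ [c])) rows [] []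

theorem forcesQuad_triangle : forcesQuad 5 [[], [true], [true, true]] = true := by
  decide +kernel

/-- The pairs `i j`, `i k`, `i l` have the same values under `F` as the complementary pairs. -/
def IsQuad (F : ℕ → ℕ → Bool) (i j k l : ℕ) : Prop :=
  F i j = F k l ∧ F i k = F j l ∧ F i l = F j k

theorem exists_of_anyMatch {b x y : Bool} {f g h : ℕ → Bool} {n : ℕ}
    (H : anyMatch b x y (descList f n) (descList g n) (descList h n) = true) :
    ∃ i < n, f i = y ∧ g i = x ∧ h i = b := by
  induction n with
  | zero => simp [descList, anyMatch] at H
  | succ n ih =>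
    simp only [descList, anyMatch, Bool.or_eq_true, Bool.and_eq_true, beq_iff_eq] at H
    rcases H with H | H
    · exact ⟨n, n.lt_succ_self, H⟩
    · obtain ⟨i, hi, H⟩ := ih H
      exact ⟨i, hi.trans n.lt_succ_self, H⟩

/-- The values `F i k` for `i < k`, in descending order of `i`. -/
def row (F : ℕ → ℕ → Bool) (k : ℕ) : List Bool :=
  descList (F · k) k

theorem exists_of_anyQuad {F : ℕ → ℕ → Bool} {k l n : ℕ}
    (H : anyQuad (F k l) (descList (F · k) n) (descList (F · l) n) (descList (row F) n) = true) :
    ∃ i j, i < j ∧ j < n ∧ IsQuad F i j k l := by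
  induction n with
  | zero => simp [descList, anyQuad] at H
  | succ n ih =>
    rw [descList, descList, descList, anyQuad, Bool.or_eq_true] at H
    rcases H with H | H
    · obtain ⟨i, hi, h₁, h₂, h₃⟩ := exists_of_anyMatch H
      exact ⟨i, n, hi, n.lt_succ_self, h₃, h₁, h₂⟩
    · obtain ⟨i, j, hij, hj, H⟩ := ih H
      exact ⟨i, j, hij, hj.trans n.lt_succ_self, H⟩

theorem exists_of_addVertex {F : ℕ → ℕ → Bool} {next : List Bool → Bool} (m k : ℕ)
    (H : addVertex next ((List.range' k m).map (row F)) (descList (row F) k)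
      (descList (F · (k + m)) k) = true) :
    next (row F (k + m)) = true ∨
      ∃ i j k', i < j ∧ j < k' ∧ k' < k + m ∧ IsQuad F i j k' (k + m) := by
  induction m generalizing k with
  | zero => exact Or.inl H
  | succ m ih =>
    rw [List.range'_succ, List.map_cons, addVertex, Bool.and_eq_true] at H
    have H' : (anyQuad (F k (k + (m + 1))) (row F k) (descList (F · (k + (m + 1))) k)
        (descList (row F) k) || addVertex next ((List.range' (k + 1) m).map (row F))
          (descList (row F) (k + 1)) (descList (F · (k + (m + 1))) (k + 1))) = true := by
      rw [descList, descList]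
      cases F k (k + (m + 1))
      exacts [H.2, H.1]
    rcases Bool.or_eq_true_iff.1 H' with H' | H'
    · obtain ⟨i, j, hij, hj, H'⟩ := exists_of_anyQuad H'
      exact Or.inr ⟨i, j, k, hij, hj, by omega, H'⟩
    · rw [show k + (m + 1) = k + 1 + m by omega] at H' ⊢
      exact ih (k + 1) H'

theorem exists_of_forcesQuad {F : ℕ → ℕ → Bool} (n l : ℕ)
    (H : forcesQuad n ((List.range l).map (row F)) = true) :
    ∃ i j k l', i < j ∧ j < k ∧ k < l' ∧ l' < l + n ∧ IsQuad F i j k l' := by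
  induction n generalizing l with
  | zero => simp [forcesQuad] at H
  | succ n ih =>
    rw [forcesQuad, List.range_eq_range'] at H
    have H' := exists_of_addVertex (F := F) l 0 (by rw [Nat.zero_add]; exact H)
    simp only [Nat.zero_add] at H'
    rcases H' with H' | ⟨i, j, k, hij, hjk, hkl, H'⟩
    · rw [← List.range_eq_range', ← List.map_singleton, ← List.map_append,
        ← List.range_succ] at H'
      obtain ⟨i, j, k, l', hij, hjk, hkl, hl, H'⟩ := ih (l + 1) H'
      exact ⟨i, j, k, l', hij, hjk, hkl, by omega, H'⟩
    · exact ⟨i, j, k, l, hij, hjk, hkl, by omega, H'⟩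

open Finset in
/-- Among eight vertices some three are pairwise adjacent or pairwise non-adjacent. -/
theorem exists_monochromatic_triangle (G : SimpleGraph (Fin 8)) [DecidableRel G.Adj] :
    ∃ (b : Bool) (x y z : Fin 8), x ≠ y ∧ x ≠ z ∧ y ≠ z ∧
      decide (G.Adj x y) = b ∧ decide (G.Adj x z) = b ∧ decide (G.Adj y z) = b := by
  obtain ⟨b, -, hb⟩ := exists_lt_card_fiber_of_mul_lt_card_of_maps_to (n := 2)
    (s := ({0}ᶜ : Finset (Fin 8))) (t := (univ : Finset Bool))
    (f := fun v ↦ decide (G.Adj 0 v)) (fun _ _ ↦ mem_univ _) (by decide)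
  obtain ⟨x, hx, y, hy, z, hz, hxy, hxz, hyz⟩ := two_lt_card.1 hb
  simp only [mem_filter, mem_compl, mem_singleton] at hx hy hz
  by_cases h₁ : decide (G.Adj x y) = b
  · exact ⟨b, 0, x, y, Ne.symm hx.1, Ne.symm hy.1, hxy, hx.2, hy.2, h₁⟩
  by_cases h₂ : decide (G.Adj x z) = b
  · exact ⟨b, 0, x, z, Ne.symm hx.1, Ne.symm hz.1, hxz, hx.2, hz.2, h₂⟩
  by_cases h₃ : decide (G.Adj y z) = b
  · exact ⟨b, 0, y, z, Ne.symm hy.1, Ne.symm hz.1, hyz, hy.2, hz.2, h₃⟩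
  exact ⟨!b, x, y, z, hxy, hxz, hyz, Bool.eq_not_of_ne h₁, Bool.eq_not_of_ne h₂,
    Bool.eq_not_of_ne h₃⟩

theorem hasRegEq_four_of_fin_eight (G : SimpleGraph (Fin 8)) : HasRegEq G 4 := by
  classical
  obtain ⟨b, x, y, z, hxy, hxz, hyz, h₁, h₂, h₃⟩ := exists_monochromatic_triangle G
  obtain ⟨g, hg⟩ : ∃ g : Equiv.Perm (Fin 8), g 0 = x ∧ g 1 = y ∧ g 2 = z := by
    have hinj : Function.Injective ![x, y, z] := by
      intro i j hij
      fin_cases i <;> fin_cases j <;> simp_all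
    have := Equiv.Perm.isMultiplyPretransitive (Fin 8) 3
    obtain ⟨g, hg⟩ := MulAction.exists_smul_eq (Equiv.Perm (Fin 8))
      (⟨![0, 1, 2], by decide⟩ : Fin 3 ↪ Fin 8) ⟨![x, y, z], hinj⟩
    exact ⟨g, DFunLike.congr_fun hg 0, DFunLike.congr_fun hg 1, DFunLike.congr_fun hg 2⟩
  let F : ℕ → ℕ → Bool := fun i j ↦ decide (G.Adj (g (Fin.ofNat 8 i)) (g (Fin.ofNat 8 j))) == b
  have hF (i j k l : ℕ) (h : F i j = F k l) :
      G.Adj (g (Fin.ofNat 8 i)) (g (Fin.ofNat 8 j)) ↔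
        G.Adj (g (Fin.ofNat 8 k)) (g (Fin.ofNat 8 l)) := by
    rw [← decide_eq_decide]
    exact (by decide : ∀ p q b : Bool, (p == b) = (q == b) → p = q) _ _ _ h
  have hrows : (List.range 3).map (row F) = [[], [true], [true, true]] := by
    have h01 : F 0 1 = true := by
      change (decide (G.Adj (g 0) (g 1)) == b) = true
      rwa [hg.1, hg.2.1, beq_iff_eq]
    have h02 : F 0 2 = true := by
      change (decide (G.Adj (g 0) (g 2)) == b) = true
      rwa [hg.1, hg.2.2, beq_iff_eq]
    have h12 : F 1 2 = true := by
      change (decide (G.Adj (g 1) (g 2)) == b) = true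
      rwa [hg.2.1, hg.2.2, beq_iff_eq]
    simp [List.range_succ, row, descList, h01, h02, h12]
  obtain ⟨i, j, k, l, hij, hjk, hkl, hl, hi, hk, h⟩ :=
    exists_of_forcesQuad (F := F) 5 3 (hrows ▸ forcesQuad_triangle)
  refine (hasRegEq_four_iff G).2 ⟨_, _, _, _, ?_, hF _ _ _ _ hi, hF _ _ _ _ hk, hF _ _ _ _ h⟩
  simp only [ne_eq, g.injective.eq_iff, Fin.ext_iff, Fin.val_ofNat]
  omega

/-- The disjoint union of an isolated vertex `6` and the wheel with hub `5` over the cycle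
`0, 1, 2, 3, 4`. -/
def wheelWithIsolated : SimpleGraph (Fin 7) :=
  SimpleGraph.fromRel fun a b ↦ a < 5 ∧ (b = 5 ∨ b < 5 ∧ b.val = (a.val + 1) % 5)

instance : DecidableRel wheelWithIsolated.Adj := fun a b ↦
  inferInstanceAs (Decidable (a ≠ b ∧ _))

theorem not_hasRegEq_wheelWithIsolated : ¬ HasRegEq wheelWithIsolated 4 := by
  rw [hasRegEq_four_iff]
  decide +kernel

theorem Neq_four :
    (∀ G : SimpleGraph (Fin 8), HasRegEq G 4) ∧
    (∃ G : SimpleGraph (Fin 7), ¬ HasRegEq G 4) ∧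
    Neq 4 = 8 := by
  refine ⟨hasRegEq_four_of_fin_eight, ⟨_, not_hasRegEq_wheelWithIsolated⟩, ?_⟩
  refine le_antisymm (Nat.sInf_le hasRegEq_four_of_fin_eight)
    (le_csInf ⟨8, hasRegEq_four_of_fin_eight⟩ fun n hn ↦ ?_)
  by_contra! hlt
  exact not_hasRegEq_wheelWithIsolated
    (HasRegEq.of_comap (Fin.castLEEmb (Nat.le_of_lt_succ hlt)) (hn _))
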